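/- Let m ≥ 1 and let n_1, …, n_m be positive integers with n = n_1 + … + n_m ≥ 2 and e = Σ_{1≤i<j≤m} n_i n_j. Then the minimum number k such that the edge set of the complete m-partite graph K_{n_1,…,n_m} can be partitioned into k sets, each of which induces an acyclic subgraph (a forest), is exactly ⌈e/(n−1)⌉. (This is the paper's Lemma: the arboricity θ(∞, K_{n_1,…,n_m}) equals ⌈e/(n−1)⌉.) -/

import Mathlib

open SimpleGraph Finset

namespace SimpleGraph

variable {V ι : Type*}

/-- The subgraph of `G` formed by the edges which the partial edge colouring `c` colours `i`. -/
def partialColorClass (G : SimpleGraph V) (c : Sym2 V → Option ι) (i : ι) : SimpleGraph V where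
  Adj x y := G.Adj x y ∧ c s(x, y) = some i
  symm := ⟨fun x y h ↦ ⟨h.1.symm, by rw [Sym2.eq_swap]; exact h.2⟩⟩
  loopless := ⟨fun x h ↦ G.loopless.irrefl x h.1⟩

/-- Every colour class of the partial edge colouring `c` is a forest. -/
def IsForestColoring (G : SimpleGraph V) (c : Sym2 V → Option ι) : Prop :=
  ∀ i, (G.partialColorClass c i).IsAcyclic

/-- The edges of `G` left uncoloured by `c`. -/
def uncolored (G : SimpleGraph V) (c : Sym2 V → Option ι) : Set (Sym2 V) :=
  {e | e ∈ G.edgeSet ∧ c e = none}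

open Classical in
/-- The colouring `c'` arises from `c` by giving colour `i` to an uncoloured edge `xy` and
uncolouring an edge of a path from `x` to `y` in colour `i`. -/
def IsExchange (G : SimpleGraph V) (c c' : Sym2 V → Option ι) : Prop :=
  ∃ (x y : V) (i : ι) (p : (G.partialColorClass c i).Walk x y) (f : Sym2 V),
    G.Adj x y ∧ c s(x, y) = none ∧ p.IsPath ∧ f ∈ p.edges ∧
      c' = Function.update (Function.update c s(x, y) (some i)) f none

/-- The edges left uncoloured by some colouring obtained from `c` by exchanges. -/
def exchangeableEdges (G : SimpleGraph V) (c : Sym2 V → Option ι) : Set (Sym2 V) :=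
  {e | ∃ c', Relation.ReflTransGen G.IsExchange c c' ∧ e ∈ G.uncolored c'}

lemma reachable_of_forall_adj {G H : SimpleGraph V}
    (h : ∀ x y, G.Adj x y → H.Reachable x y) {x y : V} (hxy : G.Reachable x y) :
    H.Reachable x y := by
  obtain ⟨p⟩ := hxy
  induction p with
  | nil => rfl
  | cons hadj _ ih => exact (h _ _ hadj).trans ih

/-- In a forest, deleting an edge of a path disconnects its ends. -/
lemma IsAcyclic.not_reachable_deleteEdges {G : SimpleGraph V} (hG : G.IsAcyclic) {x y : V}
    {p : G.Walk x y} (hp : p.IsPath) {f : Sym2 V} (hf : f ∈ p.edges) :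
    ¬ (G.deleteEdges {f}).Reachable x y := by
  rintro h
  obtain ⟨q, hq⟩ := h.exists_isPath
  have hle : G.deleteEdges {f} ≤ G := deleteEdges_le _
  have heq := (hG.subsingleton_path x y).elim ⟨p, hp⟩ ⟨q.mapLe hle, hq.mapLe hle⟩
  have hpq : p = q.mapLe hle := congrArg Subtype.val heq
  rw [hpq, Walk.edges_mapLe_eq_edges] at hf
  have := q.edges_subset_edgeSet hf
  simp [edgeSet_deleteEdges] at this

open Classical in
lemma IsForestColoring.update_update {G : SimpleGraph V} {c : Sym2 V → Option ι}
    (hc : G.IsForestColoring c) {x y : V} {i : ι}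
    {p : (G.partialColorClass c i).Walk x y} (hp : p.IsPath) {f : Sym2 V} (hf : f ∈ p.edges) :
    G.IsForestColoring
      (Function.update (Function.update c s(x, y) (some i)) f none) := by
  intro j
  by_cases hij : j = i
  · subst hij
    refine IsAcyclic.anti ?_ (IsAcyclic.sup_edge_of_not_reachable
      ((hc j).not_reachable_deleteEdges hp hf) ((hc j).anti (deleteEdges_le _)))
    intro a b hab
    obtain ⟨h1, h2⟩ := hab
    by_cases h : s(a, b) = f
    · simp [h] at h2
    rw [Function.update_of_ne h] at h2
    by_cases h' : s(a, b) = s(x, y)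
    · right
      rw [edge_adj]
      exact ⟨Sym2.eq_iff.mp h', h1.ne⟩
    · rw [Function.update_of_ne h'] at h2
      left
      rw [deleteEdges_adj]
      exact ⟨⟨h1, h2⟩, by simpa using h⟩
  · refine (hc j).anti ?_
    rintro a b ⟨h1, h2⟩
    by_cases h : s(a, b) = f
    · simp [h] at h2
    rw [Function.update_of_ne h] at h2
    by_cases h' : s(a, b) = s(x, y)
    · rw [h', Function.update_self] at h2
      exact absurd (Option.some.inj h2).symm hij
    · rw [Function.update_of_ne h'] at h2
      exact ⟨h1, h2⟩

lemma mem_edges_partialColorClass {G : SimpleGraph V} {c : Sym2 V → Option ι} {x y : V} {i : ι}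
    {p : (G.partialColorClass c i).Walk x y} {f : Sym2 V} (hf : f ∈ p.edges) :
    f ∈ G.edgeSet ∧ c f = some i := by
  have := p.edges_subset_edgeSet hf
  induction f with
  | _ a b => exact this

lemma IsExchange.isForestColoring {G : SimpleGraph V} {c c' : Sym2 V → Option ι}
    (h : G.IsExchange c c') (hc : G.IsForestColoring c) : G.IsForestColoring c' := by
  obtain ⟨x, y, i, p, f, -, -, hp, hf, rfl⟩ := h
  exact hc.update_update hp hf

lemma IsExchange.ncard_uncolored [Finite V] {G : SimpleGraph V} {c c' : Sym2 V → Option ι}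
    (h : G.IsExchange c c') : (G.uncolored c').ncard = (G.uncolored c).ncard := by
  classical
  obtain ⟨x, y, i, p, f, hxy, hnone, hp, hf, rfl⟩ := h
  obtain ⟨hfG, hfc⟩ := mem_edges_partialColorClass hf
  have hne : s(x, y) ≠ f := by rintro rfl; simp [hnone] at hfc
  have : G.uncolored (Function.update (Function.update c s(x, y) (some i)) f none) =
      insert f (G.uncolored c \ {s(x, y)}) := by
    ext e
    simp only [uncolored, Set.mem_ofPred_eq, Set.mem_insert_iff, Set.mem_sdiff,
      Set.mem_singleton_iff]
    by_cases h : e = f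
    · simp [h, hfG]
    by_cases h' : e = s(x, y)
    · subst h'; simp [h]
    · simp [h, h']
  rw [this]
  exact Set.ncard_exchange (by simp [uncolored, hfc]) (by simp [uncolored, hxy, hnone])

/-- A forest colouring leaving as few edges as possible uncoloured. -/
def IsOptimalForestColoring (G : SimpleGraph V) (c : Sym2 V → Option ι) : Prop :=
  G.IsForestColoring c ∧
    ∀ c' : Sym2 V → Option ι, G.IsForestColoring c' →
      (G.uncolored c).ncard ≤ (G.uncolored c').ncard

lemma exists_isOptimalForestColoring (G : SimpleGraph V) (ι : Type*) :
    ∃ c : Sym2 V → Option ι, G.IsOptimalForestColoring c := by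
  have hne : {c : Sym2 V → Option ι | G.IsForestColoring c}.Nonempty := by
    refine ⟨fun _ ↦ none, fun i ↦ ?_⟩
    convert! isAcyclic_bot (V := V)
    ext a b
    simp [partialColorClass]
  exact ⟨Function.argminOn (fun c ↦ (G.uncolored c).ncard) _ hne,
    Function.argminOn_mem (fun c ↦ (G.uncolored c).ncard) _ hne,
    fun c' hc' ↦ Function.argminOn_le (fun c ↦ (G.uncolored c).ncard) _ hc'⟩

lemma IsExchange.isOptimalForestColoring [Finite V] {G : SimpleGraph V}
    {c c' : Sym2 V → Option ι} (h : G.IsExchange c c') (hc : G.IsOptimalForestColoring c) :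
    G.IsOptimalForestColoring c' :=
  ⟨h.isForestColoring hc.1, fun d hd ↦ h.ncard_uncolored.trans_le (hc.2 d hd)⟩

/-- The ends of an edge left uncoloured by an optimal colouring are joined in each colour. -/
lemma IsOptimalForestColoring.reachable [Finite V] {G : SimpleGraph V} {c : Sym2 V → Option ι}
    (hc : G.IsOptimalForestColoring c) {x y : V} (hxy : s(x, y) ∈ G.uncolored c) (i : ι) :
    (G.partialColorClass c i).Reachable x y := by
  classical
  by_contra hr
  have hforest : G.IsForestColoring (Function.update c s(x, y) (some i)) := by
    intro j
    by_cases hij : j = i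
    · subst hij
      refine ((hc.1 j).sup_edge_of_not_reachable hr).anti ?_
      rintro a b ⟨h1, h2⟩
      by_cases h' : s(a, b) = s(x, y)
      · right
        rw [edge_adj]
        exact ⟨Sym2.eq_iff.mp h', h1.ne⟩
      · rw [Function.update_of_ne h'] at h2
        exact Or.inl ⟨h1, h2⟩
    · refine (hc.1 j).anti ?_
      rintro a b ⟨h1, h2⟩
      by_cases h' : s(a, b) = s(x, y)
      · rw [h', Function.update_self] at h2
        exact absurd (Option.some.inj h2).symm hij
      · rw [Function.update_of_ne h'] at h2
        exact ⟨h1, h2⟩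
  refine (hc.2 _ hforest).not_gt (Set.ncard_lt_ncard ?_)
  refine ⟨fun e he ↦ ?_, fun hsub ↦ ?_⟩
  · obtain ⟨h1, h2⟩ := he
    by_cases h' : e = s(x, y)
    · simp [h'] at h2
    · rw [Function.update_of_ne h'] at h2
      exact ⟨h1, h2⟩
  · simpa using (hsub hxy).2

/-- Exchanges within a graph `H` do not enlarge the connected components of the
colour classes restricted to `H`. -/
lemma IsExchange.reachable_inf {G H : SimpleGraph V} {c c' : Sym2 V → Option ι}
    (h : G.IsExchange c c')
    (hH : ∀ d, G.IsExchange c d → G.uncolored d ⊆ H.edgeSet) {i : ι} {x y : V}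
    (hr : (G.partialColorClass c' i ⊓ H).Reachable x y) :
    (G.partialColorClass c i ⊓ H).Reachable x y := by
  classical
  obtain ⟨a, b, j, p, f, hab, hnone, hp, hf, rfl⟩ := h
  refine reachable_of_forall_adj ?_ hr
  rintro u v ⟨⟨h1, h2⟩, h3⟩
  by_cases hf' : s(u, v) = f
  · simp [hf'] at h2
  rw [Function.update_of_ne hf'] at h2
  by_cases h' : s(u, v) = s(a, b)
  · have hji : j = i := by
      rw [h', Function.update_self] at h2
      exact Option.some.inj h2
    subst hji
    have hmem : ∀ e ∈ p.edges, e ∈ (G.partialColorClass c j ⊓ H).edgeSet := by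
      intro e he
      have h4 := p.edges_subset_edgeSet he
      have h5 := hH _ ⟨a, b, j, p, e, hab, hnone, hp, he, rfl⟩
        ⟨(mem_edges_partialColorClass he).1, Function.update_self ..⟩
      rw [edgeSet_inf]
      exact ⟨h4, h5⟩
    have hreach : (G.partialColorClass c j ⊓ H).Reachable a b := ⟨p.transfer _ hmem⟩
    rcases Sym2.eq_iff.mp h' with ⟨rfl, rfl⟩ | ⟨rfl, rfl⟩
    · exact hreach
    · exact hreach.symm
  · rw [Function.update_of_ne h'] at h2
    exact Adj.reachable ⟨⟨h1, h2⟩, h3⟩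

lemma edgeSet_fromEdgeSet_exchangeableEdges (G : SimpleGraph V) (c : Sym2 V → Option ι) :
    (fromEdgeSet (G.exchangeableEdges c)).edgeSet = G.exchangeableEdges c := by
  rw [edgeSet_fromEdgeSet, sdiff_eq_left, Set.disjoint_left]
  rintro e ⟨c', -, he, -⟩
  exact G.not_isDiag_of_mem_edgeSet he

/-- The exchangeable edges and those of any one colour have the same components. -/
lemma IsOptimalForestColoring.reachable_inf_exchangeableEdges [Finite V] {G : SimpleGraph V}
    {c : Sym2 V → Option ι} (hc : G.IsOptimalForestColoring c) (i : ι) {x y : V}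
    (hxy : (fromEdgeSet (G.exchangeableEdges c)).Reachable x y) :
    (G.partialColorClass c i ⊓ fromEdgeSet (G.exchangeableEdges c)).Reachable x y := by
  classical
  refine reachable_of_forall_adj ?_ hxy
  intro u v huv
  rw [← mem_edgeSet, edgeSet_fromEdgeSet_exchangeableEdges] at huv
  obtain ⟨c', hcc', huv⟩ := huv
  set H := fromEdgeSet (G.exchangeableEdges c) with hH
  have hsub : ∀ d, Relation.ReflTransGen G.IsExchange c d → G.uncolored d ⊆ H.edgeSet := by
    intro d hd e he
    rw [hH, edgeSet_fromEdgeSet_exchangeableEdges]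
    exact ⟨d, hd, he⟩
  have hopt : ∀ d, Relation.ReflTransGen G.IsExchange c d → G.IsOptimalForestColoring d := by
    intro d hd
    induction hd with
    | refl => exact hc
    | tail _ h ih => exact h.isOptimalForestColoring ih
  have hback : ∀ d, Relation.ReflTransGen G.IsExchange c d →
      (G.partialColorClass d i ⊓ H).Reachable u v →
      (G.partialColorClass c i ⊓ H).Reachable u v := by
    intro d hd
    induction hd with
    | refl => exact id
    | tail hd h ih =>
      exact fun hr ↦ ih (h.reachable_inf (fun d' hd' ↦ hsub d' (hd.tail hd')) hr)
  refine hback c' hcc' ?_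
  obtain ⟨p, hp⟩ := ((hopt c' hcc').reachable huv i).exists_isPath
  refine ⟨p.transfer _ fun e he ↦ ?_⟩
  rw [edgeSet_inf]
  exact ⟨p.edges_subset_edgeSet he, hsub _ (hcc'.tail ⟨u, v, i, p, e, huv.1, huv.2, hp, he, rfl⟩)
    ⟨(mem_edges_partialColorClass he).1, Function.update_self ..⟩⟩

open Classical in
/-- A tree component of a graph, counted through edges of the ambient graph. -/
lemma IsAcyclic.card_edgeFinset_inter_sym2 [Fintype V] {F : SimpleGraph V} (hF : F.IsAcyclic)
    (C : F.ConnectedComponent) :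
    #(F.edgeFinset ∩ C.supp.toFinset.sym2) + 1 = #C.supp.toFinset := by
  have h := (hF.isTree_connectedComponent C).card_edgeFinset
  have h2 : #C.supp.toFinset = Fintype.card C := by
    rw [Set.toFinset_card]; exact Fintype.card_congr (Equiv.refl _)
  rw [h2, ← h, ← Finset.card_map (Function.Embedding.subtype (· ∈ C.supp)).sym2Map]
  congr 2
  ext e
  simp only [Finset.mem_inter, mem_edgeFinset, Finset.mem_sym2_iff, Set.mem_toFinset,
    Finset.mem_map]
  constructor
  · rintro ⟨h1, h2⟩
    induction e with
    | _ a b =>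
      exact ⟨s(⟨a, h2 a (by simp)⟩, ⟨b, h2 b (by simp)⟩), h1, rfl⟩
  · rintro ⟨e, he, rfl⟩
    induction e with
    | _ a b =>
      refine ⟨he, ?_⟩
      intro d hd
      have : d = a.1 ∨ d = b.1 := by simpa using hd
      rcases this with rfl | rfl
      · exact a.2
      · exact b.2

open Classical in
/-- **Nash-Williams' arboricity theorem**, the sufficiency of the density condition. -/
theorem exists_isForestColoring_of_card_le [Fintype V] [Fintype ι] (G : SimpleGraph V)
    (h : ∀ U : Finset V, U.Nonempty →
      #(G.edgeFinset ∩ U.sym2) + Fintype.card ι ≤ Fintype.card ι * #U) :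
    ∃ c : Sym2 V → Option ι, G.IsForestColoring c ∧ ∀ e ∈ G.edgeSet, c e ≠ none := by
  obtain ⟨c, hc⟩ := G.exists_isOptimalForestColoring ι
  refine ⟨c, hc.1, fun e₀ he₀ hnone ↦ ?_⟩
  induction e₀ with
  | _ a b =>
  obtain ⟨H, hH⟩ : ∃ H, H = fromEdgeSet (G.exchangeableEdges c) := ⟨_, rfl⟩
  have hab : H.Adj a b := by
    rw [← mem_edgeSet, hH, edgeSet_fromEdgeSet_exchangeableEdges]
    exact ⟨c, .refl, he₀, hnone⟩
  set U := (H.connectedComponentMk a).supp.toFinset with hU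
  have haU : a ∈ U := by simp [hU]
  have hbU : b ∈ U := by simpa [hU] using hab.symm.reachable
  let F : ι → SimpleGraph V := fun i ↦ G.partialColorClass c i ⊓ H
  have hreach : ∀ i {x y : V}, H.Reachable x y → (F i).Reachable x y := by
    subst hH
    exact fun i _ _ hr ↦ hc.reachable_inf_exchangeableEdges i hr
  have hF : ∀ i, #((F i).edgeFinset ∩ U.sym2) + 1 = #U := by
    intro i
    have hsupp : U = ((F i).connectedComponentMk a).supp.toFinset := by
      ext v
      simp only [hU, Set.mem_toFinset, ConnectedComponent.mem_supp_iff, ConnectedComponent.eq]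
      exact ⟨hreach i, fun hr ↦ hr.mono inf_le_right⟩
    rw [hsupp]
    have hFi : (F i).IsAcyclic := (hc.1 i).anti inf_le_left
    convert! hFi.card_edgeFinset_inter_sym2 ((F i).connectedComponentMk a)
  have hmem : ∀ i, ∀ e ∈ (F i).edgeFinset, e ∈ G.edgeSet ∧ c e = some i := by
    intro i e he
    induction e with
    | _ u v =>
      rw [mem_edgeFinset] at he
      exact he.1
  have hdisj : (Set.univ : Set ι).PairwiseDisjoint fun i ↦ (F i).edgeFinset ∩ U.sym2 := by
    intro i _ j _ hij
    rw [Function.onFun, Finset.disjoint_left]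
    intro e hi hj
    have h1 := (hmem i e (Finset.mem_inter.mp hi).1).2
    have h2 := (hmem j e (Finset.mem_inter.mp hj).1).2
    exact hij (Option.some.inj (h1.symm.trans h2))
  have hnot : s(a, b) ∉ Finset.univ.biUnion fun i ↦ (F i).edgeFinset ∩ U.sym2 := by
    intro hmem'
    obtain ⟨i, -, hi⟩ := Finset.mem_biUnion.mp hmem'
    have := (hmem i _ (Finset.mem_inter.mp hi).1).2
    simp [hnone] at this
  have hsub : insert s(a, b) (Finset.univ.biUnion fun i ↦ (F i).edgeFinset ∩ U.sym2) ⊆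
      G.edgeFinset ∩ U.sym2 := by
    intro e he
    rcases Finset.mem_insert.mp he with rfl | he
    · simpa [haU, hbU] using he₀
    · obtain ⟨i, -, hi⟩ := Finset.mem_biUnion.mp he
      rw [Finset.mem_inter] at hi ⊢
      exact ⟨mem_edgeFinset.mpr (hmem i _ hi.1).1, hi.2⟩
  have hcard := Finset.card_le_card hsub
  rw [Finset.card_insert_of_notMem hnot, Finset.card_biUnion (by simpa using hdisj)] at hcard
  have hsum : ∑ i : ι, (#((F i).edgeFinset ∩ U.sym2) + 1) = Fintype.card ι * #U := by
    simp [hF]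
  rw [Finset.sum_add_distrib] at hsum
  have := h U ⟨a, haU⟩
  simp at hsum
  omega

open Classical in
lemma IsCompleteMultipartite.card_edgeFinset_inter_sym2_le [Fintype V] {G : SimpleGraph V}
    (hG : G.IsCompleteMultipartite) (U : Finset V) (v : V) :
    #(G.edgeFinset ∩ U.sym2) ≤ #{w ∈ U | G.Adj v w} * (#U - 1) := by
  have hsub : G.edgeFinset ∩ U.sym2 ⊆
      {w ∈ U | G.Adj v w}.biUnion fun w ↦ (U.erase w).image (s(w, ·)) := by
    intro e he
    induction e with
    | _ x y =>
    simp only [Finset.mem_inter, mem_edgeFinset, mem_edgeSet, Finset.mk_mem_sym2_iff] at he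
    obtain ⟨hxy, hx, hy⟩ := he
    rw [Finset.mem_biUnion]
    by_cases hvx : G.Adj v x
    · exact ⟨x, by simp [hx, hvx], Finset.mem_image.mpr ⟨y, by simp [hy, hxy.ne'], rfl⟩⟩
    by_cases hvy : G.Adj v y
    · exact ⟨y, by simp [hy, hvy],
        Finset.mem_image.mpr ⟨x, by simp [hx, hxy.ne], Sym2.eq_swap⟩⟩
    · exact absurd hxy (hG.trans x v y (fun h ↦ hvx h.symm) hvy)
  refine (Finset.card_le_card hsub).trans (Finset.card_biUnion_le_card_mul _ _ _ fun w hw ↦ ?_)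
  exact Finset.card_image_le.trans (Finset.card_erase_of_mem (Finset.mem_filter.mp hw).1).le

open Classical in
lemma card_edgeFinset_inter_sym2_erase_add_le [Fintype V] (G : SimpleGraph V) {U : Finset V}
    {v : V} (hv : v ∈ U) :
    #(G.edgeFinset ∩ (U.erase v).sym2) + #{w ∈ U | G.Adj v w} ≤ #(G.edgeFinset ∩ U.sym2) := by
  have hinj : Function.Injective fun w ↦ s(v, w) := fun x y hxy ↦ Sym2.congr_right.mp hxy
  rw [← Finset.card_image_of_injective {w ∈ U | G.Adj v w} hinj, ← Finset.card_union_of_disjoint]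
  · refine Finset.card_le_card (Finset.union_subset ?_ ?_)
    · exact Finset.inter_subset_inter_left (Finset.sym2_mono (Finset.erase_subset _ _))
    · intro e he
      obtain ⟨w, hw, rfl⟩ := Finset.mem_image.mp he
      simp only [Finset.mem_filter] at hw
      simp [hw.1, hw.2, hv]
  · rw [Finset.disjoint_left]
    intro e he he'
    obtain ⟨w, hw, rfl⟩ := Finset.mem_image.mp he'
    simp at he

open Classical in
/-- The density bound of a complete multipartite graph is inherited by its induced subgraphs. -/
lemma IsCompleteMultipartite.card_edgeFinset_inter_sym2_add_le [Fintype V] {G : SimpleGraph V}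
    (hG : G.IsCompleteMultipartite) {k : ℕ} (h : #G.edgeFinset + k ≤ k * Fintype.card V)
    (U : Finset V) (hU : U.Nonempty) : #(G.edgeFinset ∩ U.sym2) + k ≤ k * #U := by
  induction hs : #Uᶜ generalizing U with
  | zero =>
    have : U = Finset.univ := by simpa using hs
    subst this
    simpa using h
  | succ s ih =>
    obtain ⟨v, hv⟩ : Uᶜ.Nonempty := by rw [← Finset.card_pos]; omega
    have hv' : v ∉ U := by simpa using hv
    have ih' := ih (insert v U) (by simp) (by
      rw [Finset.compl_insert, Finset.card_erase_of_mem hv, hs]; rfl)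
    have h1 := hG.card_edgeFinset_inter_sym2_le (insert v U) v
    have h2 := G.card_edgeFinset_inter_sym2_erase_add_le (Finset.mem_insert_self v U)
    rw [Finset.erase_insert hv'] at h2
    rw [Finset.card_insert_of_notMem hv'] at ih' h1
    set d := #{w ∈ insert v U | G.Adj v w}
    rw [Nat.add_sub_cancel] at h1
    obtain ⟨t, ht⟩ : ∃ t, #U = t + 1 := ⟨#U - 1, by have := hU.card_pos; omega⟩
    rw [ht] at h1 ih' ⊢
    rcases le_total k d with hkd | hkd
    · nlinarith
    · have : d * t ≤ k * t := Nat.mul_le_mul_right t hkd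
      nlinarith

lemma IsCompleteMultipartite.exists_isForestColoring [Finite V] [Fintype ι] {G : SimpleGraph V}
    (hG : G.IsCompleteMultipartite)
    (h : G.edgeSet.ncard + Fintype.card ι ≤ Fintype.card ι * Nat.card V) :
    ∃ c : Sym2 V → Option ι, G.IsForestColoring c ∧ ∀ e ∈ G.edgeSet, c e ≠ none := by
  classical
  have := Fintype.ofFinite V
  rw [Nat.card_eq_fintype_card, ← coe_edgeFinset, Set.ncard_coe_finset] at h
  refine G.exists_isForestColoring_of_card_le fun U hU ↦ ?_
  convert! hG.card_edgeFinset_inter_sym2_add_le (by convert! h) U hU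

lemma IsAcyclic.ncard_edgeSet_add_one_le [Finite V] [Nonempty V] {F : SimpleGraph V}
    (hF : F.IsAcyclic) : F.edgeSet.ncard + 1 ≤ Nat.card V := by
  obtain ⟨T, hFT, -, hT⟩ := connected_top.exists_isTree_le_of_le_of_isAcyclic le_top hF
  rw [← (isTree_iff_connected_and_card.mp hT).2, Nat.card_coe_set_eq, Nat.add_le_add_iff_right]
  exact Set.ncard_le_ncard (edgeSet_mono hFT)

lemma ncard_edgeSet_completeMultipartiteGraph {m : ℕ} (nn : Fin m → ℕ) :
    (completeMultipartiteGraph fun i ↦ Fin (nn i)).edgeSet.ncard =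
      ∑ i, ∑ j ∈ Finset.Ioi i, nn i * nn j := by
  classical
  have hdeg : ∀ v, (completeMultipartiteGraph fun i ↦ Fin (nn i)).degree v =
      ∑ j ∈ {v.1}ᶜ, nn j := by
    intro v
    have : (completeMultipartiteGraph fun i ↦ Fin (nn i)).neighborFinset v =
        ({v.1}ᶜ : Finset (Fin m)).sigma fun _ ↦ Finset.univ := by
      ext w
      simp [eq_comm]
    rw [← card_neighborFinset_eq_degree, this, Finset.card_sigma]
    simp
  have h := (completeMultipartiteGraph fun i ↦ Fin (nn i)).sum_degrees_eq_twice_card_edges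
  simp only [hdeg, Fintype.sum_sigma, Finset.sum_const, Finset.card_univ, Fintype.card_fin,
    smul_eq_mul] at h
  have h2 := Finset.sum_sum_Ioi_add_eq_sum_sum_off_diag fun i j ↦ nn j * nn i
  simp only [← Finset.mul_sum] at h2
  rw [h, ← coe_edgeFinset, Set.ncard_coe_finset] at *
  have h3 : ∀ i j, nn i * nn j + nn j * nn i = 2 * (nn i * nn j) := fun i j ↦ by ring
  simp only [h3, ← Finset.mul_sum] at h2
  simp only [← Finset.mul_sum]
  omega

end SimpleGraph

/-- The arboricity of the complete `m`-partite graph `K_{n_1,…,n_m}` is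
`⌈e/(n-1)⌉`, where `n` is the number of vertices and `e` the number of edges. -/
theorem arboricity_completeMultipartite (m : ℕ) (hm : 1 ≤ m) (nn : Fin m → ℕ)
    (hpos : ∀ i, 0 < nn i) (n : ℕ) (hn : n = ∑ i, nn i) (hn2 : 2 ≤ n)
    (e : ℕ) (he : e = ∑ i, ∑ j ∈ Finset.Ioi i, nn i * nn j) :
    IsLeast {k : ℕ | ∃ P : Fin k → Set (Sym2 (Σ i : Fin m, Fin (nn i))),
        (Pairwise fun i j => Disjoint (P i) (P j)) ∧
        (⋃ i, P i) = (completeMultipartiteGraph fun i => Fin (nn i)).edgeSet ∧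
        (∀ i, (SimpleGraph.fromEdgeSet (P i)).IsAcyclic)}
      ⌈(e : ℚ) / ((n : ℚ) - 1)⌉₊ := by
  classical
  have hn1 : (0 : ℚ) < (n : ℚ) - 1 := by
    have : (2 : ℚ) ≤ n := by exact_mod_cast hn2
    linarith
  have hV : Fintype.card (Σ i : Fin m, Fin (nn i)) = n := by simp [hn]
  rw [← ncard_edgeSet_completeMultipartiteGraph] at he
  set G := completeMultipartiteGraph fun i => Fin (nn i) with hG
  constructor
  · set k := ⌈(e : ℚ) / ((n : ℚ) - 1)⌉₊ with hk
    have hek : e + k ≤ k * n := by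
      have h := Nat.le_ceil ((e : ℚ) / ((n : ℚ) - 1))
      rw [← hk, div_le_iff₀ hn1] at h
      have h' : (e : ℚ) + k ≤ k * n := by linarith
      exact_mod_cast h'
    obtain ⟨c, hc, hall⟩ := (completeMultipartiteGraph.isCompleteMultipartite
      fun i ↦ Fin (nn i)).exists_isForestColoring (ι := Fin k) (by
        rwa [Nat.card_eq_fintype_card, hV, Fintype.card_fin, ← hG, ← he])
    refine ⟨fun i ↦ {x | x ∈ G.edgeSet ∧ c x = some i}, ?_, ?_, ?_⟩
    · intro i j hij
      rw [Set.disjoint_left]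
      rintro x ⟨-, hi⟩ ⟨-, hj⟩
      exact hij (Option.some.inj (hi.symm.trans hj))
    · ext x
      simp only [Set.mem_iUnion, Set.mem_ofPred_eq]
      refine ⟨fun ⟨_, hx, _⟩ ↦ hx, fun hx ↦ ?_⟩
      obtain ⟨i, hi⟩ := Option.ne_none_iff_exists'.mp (hall x hx)
      exact ⟨i, hx, hi⟩
    · intro i
      refine (hc i).anti ?_
      intro a b hab
      exact (fromEdgeSet_adj _).mp hab |>.1
  · rintro k ⟨P, -, hunion, hacyc⟩
    have : Nonempty (Σ i : Fin m, Fin (nn i)) := by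
      rw [← Fintype.card_pos_iff]; omega
    have hP : ∀ i, (P i).ncard ≤ n - 1 := by
      intro i
      have h := (hacyc i).ncard_edgeSet_add_one_le
      have hdiag : P i \ Sym2.diagSet = P i := by
        rw [sdiff_eq_left, Set.disjoint_left]
        intro x hx
        exact G.not_isDiag_of_mem_edgeSet (hunion ▸ Set.mem_iUnion_of_mem i hx)
      rw [edgeSet_fromEdgeSet, hdiag, Nat.card_eq_fintype_card, hV] at h
      omega
    have hle : e ≤ k * (n - 1) := by
      rw [he, ← hunion]
      refine (Set.ncard_iUnion_le_of_fintype P).trans ?_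
      simpa using Finset.sum_le_sum fun i (_ : i ∈ Finset.univ) ↦ hP i
    rw [Nat.ceil_le, div_le_iff₀ hn1]
    have : ((n - 1 : ℕ) : ℚ) = (n : ℚ) - 1 := by
      rw [Nat.cast_sub (by omega)]; simp
    rw [← this]
    exact_mod_cast hle
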